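/- arXiv:1812.08080 — 2 statements merged into one kernel-verified Lean document; each statement's English description precedes it below -/
import Mathlib

section
/- Let p be a prime with p ≡ 5 (mod 12). Then the determinant det[((i²+10ij+9j²)/p)]_{1≤i,j≤p−1} = 0, where (·/p) is the Legendre symbol. -/
open Finset in
theorem sum_comp_sq_eq_sum_quadraticChar {F : Type*} [Field F] [Fintype F] [DecidableEq F]
    (hF : ringChar F ≠ 2) (G : F → ℤ) :
    ∑ s, G (s ^ 2) = ∑ x, (quadraticChar F x + 1) * G x := by
  have h : ∀ x : F, (quadraticChar F x + 1) * G x = ∑ s with s ^ 2 = x, G (s ^ 2) := by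
    intro x
    rw [sum_congr rfl (g := fun _ => G x) (fun s hs => by rw [(mem_filter.1 hs).2]), sum_const,
      nsmul_eq_mul, ← quadraticChar_card_sqrts hF x]
    congr 3
    ext s
    simp
  rw [sum_congr rfl fun x _ => h x]
  exact (sum_fiberwise univ (fun s : F => s ^ 2) fun s => G (s ^ 2)).symm

open Finset in
theorem sum_comp_add_inv_eq_sum_quadraticChar {F : Type*} [Field F] [Fintype F] [DecidableEq F]
    (hF : ringChar F ≠ 2) (g : F → ℤ) :
    ∑ t, (if t = 0 then 0 else g (t + t⁻¹)) =
      ∑ u, (quadraticChar F (u ^ 2 - 4) + 1) * g u := by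
  have h2 : (2 : F) ≠ 0 := Ring.two_ne_zero hF
  have h : ∀ u : F, (quadraticChar F (u ^ 2 - 4) + 1) * g u =
      ∑ t with t ≠ 0 ∧ t + t⁻¹ = u, g (t + t⁻¹) := by
    intro u
    rw [sum_congr rfl (g := fun _ => g u) (fun s hs => by rw [(mem_filter.1 hs).2.2]), sum_const,
      nsmul_eq_mul, ← quadraticChar_card_sqrts hF (u ^ 2 - 4)]
    congr 2
    refine (card_bij' (fun t _ => 2 * t - u) (fun y _ => (u + y) / 2) ?_ ?_ ?_ ?_).symm
    · intro t ht
      obtain ⟨ht0, rfl⟩ := (mem_filter.1 ht).2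
      simp only [Set.mem_toFinset, Set.mem_ofPred_eq]
      field_simp
      ring
    · intro y hy
      simp only [Set.mem_toFinset, Set.mem_ofPred_eq] at hy
      have hm : (u + y) / 2 * ((u - y) / 2) = 1 := by
        field_simp
        linear_combination -hy
      refine mem_filter.2 ⟨mem_univ _, left_ne_zero_of_mul_eq_one hm, ?_⟩
      rw [inv_eq_of_mul_eq_one_right hm]
      field_simp
      ring
    · intro t _
      field_simp
      ring
    · intro y _
      field_simp
      ring
  rw [sum_congr rfl fun x _ => h x]
  have hs : ∀ u : F, ∑ t with t ≠ 0 ∧ t + t⁻¹ = u, g (t + t⁻¹) =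
      ∑ t ∈ univ.filter (fun t : F => t ≠ 0) with t + t⁻¹ = u, g (t + t⁻¹) := by
    intro u
    rw [filter_filter]
  rw [sum_congr rfl fun u _ => hs u, sum_fiberwise, sum_filter]
  exact sum_congr rfl fun t _ => by split_ifs <;> simp_all

open Finset in
theorem sum_quadraticChar_mul_comp_add_inv {F : Type*} [Field F] [Fintype F] [DecidableEq F]
    (hF : ringChar F ≠ 2) (g : F → ℤ) :
    ∑ t, quadraticChar F t * (if t = 0 then 0 else g (t + t⁻¹)) =
      ∑ u, (quadraticChar F (u + 2) + quadraticChar F (u - 2)) * g u := by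
  have h1 := sum_comp_sq_eq_sum_quadraticChar hF fun x => if x = 0 then 0 else g (x + x⁻¹)
  have h2 := sum_comp_add_inv_eq_sum_quadraticChar hF g
  have h3 := sum_comp_add_inv_eq_sum_quadraticChar hF fun w => g (w ^ 2 - 2)
  have h4 := sum_comp_sq_eq_sum_quadraticChar hF
    fun x => (quadraticChar F (x - 4) + 1) * g (x - 2)
  have h5 : ∑ s : F, (if s ^ 2 = 0 then 0 else g (s ^ 2 + (s ^ 2)⁻¹)) =
      ∑ s : F, (if s = 0 then 0 else g ((s + s⁻¹) ^ 2 - 2)) := by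
    refine sum_congr rfl fun s _ => ?_
    by_cases hs : s = 0
    · simp [hs]
    · rw [if_neg hs, if_neg (pow_ne_zero 2 hs)]
      congr 1
      field_simp
      ring
  have h6 : ∑ x : F, (quadraticChar F x + 1) * ((quadraticChar F (x - 4) + 1) * g (x - 2)) =
      ∑ u : F, (quadraticChar F (u + 2) + 1) * ((quadraticChar F (u - 2) + 1) * g u) := by
    refine (Fintype.sum_equiv (Equiv.addRight (2 : F)) _ _ fun u => ?_).symm
    simp only [Equiv.coe_addRight]
    congr 4
    · ring_nf
    · ring_nf
  have h7 : ∀ u : F, quadraticChar F (u ^ 2 - 4) =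
      quadraticChar F (u + 2) * quadraticChar F (u - 2) := by
    intro u
    rw [← map_mul]
    congr 1
    ring
  simp only [h7] at h2
  rw [h5, h3, h4, h6] at h1
  simp only [add_mul, one_mul, sum_add_distrib] at h1 h2 ⊢
  simp only [mul_add, sum_add_distrib, mul_assoc] at h1 h2
  linarith

theorem pow_three_bijective {p : ℕ} [Fact p.Prime] (hp : p % 3 = 2) :
    Function.Bijective fun z : ZMod p => z ^ 3 := by
  refine Finite.injective_iff_bijective.1 ?_
  obtain ⟨k, hk⟩ : ∃ k, p = 3 * k + 2 := ⟨p / 3, by omega⟩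
  have key : ∀ a : ZMod p, (a ^ 3) ^ (2 * k + 1) = a := by
    intro a
    have h : a ^ (p + (3 * k + 1)) = a := by
      rw [pow_add, ZMod.pow_card, ← pow_succ', show 3 * k + 1 + 1 = p by omega, ZMod.pow_card]
    rw [← pow_mul]
    convert h using 2
    omega
  intro a b hab
  rw [← key a, ← key b]
  exact congrArg (· ^ (2 * k + 1)) hab

section

variable {p : ℕ} [Fact p.Prime]

theorem ringChar_zmod_ne_two (hp : p % 12 = 5) : ringChar (ZMod p) ≠ 2 := by
  rw [ZMod.ringChar_zmod_n]
  omega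

theorem three_ne_zero_zmod (hp : p % 12 = 5) : (3 : ZMod p) ≠ 0 := by
  intro h
  have : p ∣ 3 := (ZMod.natCast_eq_zero_iff 3 p).1 (by exact_mod_cast h)
  have := Nat.le_of_dvd (by norm_num) this
  omega

theorem not_isSquare_three_zmod (hp : p % 12 = 5) : ¬ IsSquare (3 : ZMod p) := by
  have h3 : ∀ r : ZMod 3, ((2 : ℕ) : ZMod 3) ≠ r * r := by decide
  have : Fact (Nat.Prime 3) := ⟨Nat.prime_three⟩
  have h := ZMod.exists_sq_eq_prime_iff_of_mod_four_eq_one (p := p) (q := 3) (by omega)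
    (by norm_num)
  rw [Nat.cast_ofNat] at h
  rw [h, ← ZMod.natCast_mod, show p % 3 = 2 by omega]
  rintro ⟨r, hr⟩
  exact h3 r hr

theorem quadraticChar_three_zmod (hp : p % 12 = 5) : quadraticChar (ZMod p) 3 = -1 :=
  quadraticChar_neg_one_iff_not_isSquare.2 (not_isSquare_three_zmod hp)

theorem quadraticChar_neg_one_zmod (hp : p % 12 = 5) : quadraticChar (ZMod p) (-1) = 1 :=
  (quadraticChar_one_iff_isSquare (neg_ne_zero.2 one_ne_zero)).2
    (ZMod.exists_sq_eq_neg_one_iff.2 (by omega))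

theorem quadraticChar_mul_sq {F : Type*} [Field F] [Fintype F] [DecidableEq F] {c : F}
    (hc : c ≠ 0) (a : F) : quadraticChar F (a * c ^ 2) = quadraticChar F a := by
  rw [map_mul, quadraticChar_sq_one' hc, mul_one]

theorem sum_quadraticChar_cubic_eq_zero (hp : p % 12 = 5) :
    ∑ u : ZMod p, quadraticChar (ZMod p) (u + 2) * quadraticChar (ZMod p) (3 * u ^ 2 + 4) = 0 := by
  have h3 := three_ne_zero_zmod hp
  rw [← quadraticChar_sum_zero (ringChar_zmod_ne_two hp)]
  refine Fintype.sum_bijective (fun u : ZMod p => (3 * u + 2) ^ 3 + 64) ?_ _ _ fun u => ?_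
  · exact (Equiv.addRight (64 : ZMod p)).bijective.comp
      ((pow_three_bijective (by omega)).comp
        ((Equiv.addRight (2 : ZMod p)).bijective.comp (mulLeft_bijective₀ 3 h3)))
  · rw [← map_mul, ← quadraticChar_mul_sq h3]
    congr 1
    ring

theorem sum_quadraticChar_quartic_three_eq_zero (hp : p % 12 = 5) :
    ∑ t : ZMod p, quadraticChar (ZMod p) (3 * t ^ 4 + 10 * t ^ 2 + 3) * quadraticChar (ZMod p) t
      = 0 := by
  have h := sum_quadraticChar_mul_comp_add_inv (ringChar_zmod_ne_two hp)
    fun u => quadraticChar (ZMod p) (3 * u ^ 2 + 4)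
  have h1 := sum_quadraticChar_cubic_eq_zero hp
  have h2 : ∑ u : ZMod p,
      quadraticChar (ZMod p) (u - 2) * quadraticChar (ZMod p) (3 * u ^ 2 + 4) = 0 := by
    rw [← h1]
    refine Fintype.sum_equiv (Equiv.neg _) _ _ fun u => ?_
    simp only [Equiv.neg_apply, neg_sq]
    rw [show -u + 2 = -1 * (u - 2) by ring, map_mul, quadraticChar_neg_one_zmod hp, one_mul]
  simp only [add_mul, Finset.sum_add_distrib] at h
  rw [h1, h2, add_zero] at h
  rw [← h]
  refine Finset.sum_congr rfl fun t _ => ?_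
  by_cases ht : t = 0
  · simp [ht]
  · rw [if_neg ht, mul_comm, ← quadraticChar_mul_sq ht (3 * (t + t⁻¹) ^ 2 + 4)]
    congr 2
    field_simp
    ring

theorem sum_quadraticChar_quartic_one_eq_zero (hp : p % 12 = 5) :
    ∑ t : ZMod p, quadraticChar (ZMod p) (1 + 10 * t ^ 2 + 9 * t ^ 4) * quadraticChar (ZMod p) t
      = 0 := by
  have h3 := three_ne_zero_zmod hp
  rw [← self_eq_neg, ← Finset.sum_neg_distrib]
  refine Fintype.sum_bijective (fun t : ZMod p => (3 * t)⁻¹) ?_ _ _ fun t => ?_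
  · exact inv_involutive.bijective.comp (mulLeft_bijective₀ 3 h3)
  · by_cases ht : t = 0
    · simp [ht]
    · have e1 : quadraticChar (ZMod p) (3 * t)⁻¹ = - quadraticChar (ZMod p) t := by
        rw [← quadraticChar_mul_sq (mul_ne_zero h3 ht),
          show (3 * t)⁻¹ * (3 * t) ^ 2 = 3 * t by field_simp, map_mul,
          quadraticChar_three_zmod hp, neg_one_mul]
      rw [e1, mul_neg, neg_neg]
      congr 1
      rw [← quadraticChar_mul_sq (mul_ne_zero h3 (pow_ne_zero 2 ht))
        (1 + 10 * (3 * t)⁻¹ ^ 2 + 9 * (3 * t)⁻¹ ^ 4)]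
      congr 1
      field_simp
      ring

theorem sum_quadraticChar_quartic_eq_zero (hp : p % 12 = 5) {a : ZMod p} (ha : a ≠ 0) :
    ∑ t : ZMod p, quadraticChar (ZMod p) (a ^ 2 + 10 * a * t ^ 2 + 9 * (t ^ 2) ^ 2) *
      quadraticChar (ZMod p) t = 0 := by
  have h3 := three_ne_zero_zmod hp
  have scale : ∀ c s : ZMod p, s ≠ 0 → a = c * s ^ 2 →
      ∑ t : ZMod p, quadraticChar (ZMod p) (c ^ 2 + 10 * c * t ^ 2 + 9 * t ^ 4) *
        quadraticChar (ZMod p) t = 0 →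
      ∑ t : ZMod p, quadraticChar (ZMod p) (a ^ 2 + 10 * a * t ^ 2 + 9 * (t ^ 2) ^ 2) *
        quadraticChar (ZMod p) t = 0 := by
    intro c s hs hac h
    rw [← mul_zero (quadraticChar (ZMod p) s), ← h, Finset.mul_sum]
    refine (Fintype.sum_bijective (fun t => s * t) (mulLeft_bijective₀ s hs) _ _ fun t => ?_).symm
    rw [map_mul, mul_left_comm, hac, ← quadraticChar_mul_sq (pow_ne_zero 2 hs)
      (c ^ 2 + 10 * c * t ^ 2 + 9 * t ^ 4)]
    congr 3
    ring
  by_cases hsq : IsSquare a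
  · obtain ⟨s, hs⟩ := hsq
    refine scale 1 s (by rintro rfl; simp_all) (by rw [hs]; ring) ?_
    simpa using sum_quadraticChar_quartic_one_eq_zero hp
  · have : quadraticChar (ZMod p) (a / 3) = 1 := by
      rw [← quadraticChar_mul_sq h3, show a / 3 * 3 ^ 2 = 3 * a by field_simp, map_mul,
        quadraticChar_three_zmod hp, quadraticChar_neg_one_iff_not_isSquare.2 hsq]
      norm_num
    obtain ⟨s, hs⟩ := (quadraticChar_one_iff_isSquare (div_ne_zero ha h3)).1 this
    have has : a = 3 * s ^ 2 := by
      rw [div_eq_iff h3] at hs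
      rw [hs]
      ring
    refine scale 3 s (by rintro rfl; simp_all) has ?_
    rw [← mul_zero (quadraticChar (ZMod p) 3), ← sum_quadraticChar_quartic_three_eq_zero hp,
      Finset.mul_sum]
    refine Finset.sum_congr rfl fun t _ => ?_
    rw [← mul_assoc, ← map_mul (quadraticChar (ZMod p)) 3]
    congr 2
    ring

end

theorem sum_fin_pred_zmod {M : Type*} [AddCommMonoid M] {n : ℕ} [NeZero n] (G : ZMod n → M)
    (hG : G 0 = 0) : ∑ j : Fin (n - 1), G (((j : ℕ) : ZMod n) + 1) = ∑ x, G x := by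
  obtain ⟨m, rfl⟩ := Nat.exists_eq_succ_of_ne_zero (NeZero.ne n)
  have h := Fin.sum_univ_succ (n := m) G
  refine Eq.trans ?_ h.symm
  rw [show G (0 : Fin (m + 1)) = 0 from hG, zero_add]
  refine Finset.sum_congr rfl fun j _ => congrArg G ?_
  have hj : ((j.succ : Fin (m + 1)) : ℕ) = (j : ℕ) + 1 := rfl
  have := ZMod.natCast_zmod_val (n := m + 1) (j.succ : Fin (m + 1))
  rw [← this]
  change ((j : ℕ) : ZMod (m + 1)) + 1 = (((j : ℕ) + 1 : ℕ) : ZMod (m + 1))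
  push_cast
  rfl

theorem stmt_15 (p : ℕ) [Fact p.Prime] (hp : p % 12 = 5) :
    Matrix.det (Matrix.of fun i j : Fin (p - 1) =>
        legendreSym p ((((i : ℕ) : ℤ) + 1) ^ 2 + 10 * (((i : ℕ) : ℤ) + 1) * (((j : ℕ) : ℤ) + 1)
          + 9 * (((j : ℕ) : ℤ) + 1) ^ 2)) = 0 := by
  have hp5 : 5 ≤ p := by omega
  let V : ZMod p → ℤ := fun x => ∑ t with t ^ 2 = x, quadraticChar (ZMod p) t
  have hV0 : V 0 = 0 := Finset.sum_eq_zero fun t ht => by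
    simp only [Finset.mem_filter, Finset.mem_univ, true_and, sq_eq_zero_iff] at ht
    simp [ht]
  have hV1 : V 1 ≠ 0 := by
    have hset : (Finset.univ.filter fun t : ZMod p => t ^ 2 = 1) = {1, -1} := by
      ext t
      simp
    have hne : (1 : ZMod p) ≠ -1 := (Ring.neg_one_ne_one_of_char_ne_two
      (ringChar_zmod_ne_two hp)).symm
    change ∑ t with t ^ 2 = 1, quadraticChar (ZMod p) t ≠ 0
    rw [hset, Finset.sum_pair hne, map_one, quadraticChar_neg_one_zmod hp]
    norm_num
  refine Matrix.exists_mulVec_eq_zero_iff.1 ⟨fun j => V (((j : ℕ) : ZMod p) + 1), ?_, ?_⟩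
  · intro h
    have := congrFun h ⟨0, by omega⟩
    simp only [Nat.cast_zero, zero_add, Pi.zero_apply] at this
    exact hV1 this
  · ext i
    have ha : (((i : ℕ) : ZMod p) + 1) ≠ 0 := by
      intro h
      have hd : p ∣ (i : ℕ) + 1 := (ZMod.natCast_eq_zero_iff _ p).1 (by exact_mod_cast h)
      have := Nat.le_of_dvd (by omega) hd
      have := i.2
      omega
    simp only [Matrix.mulVec, dotProduct, Matrix.of_apply, legendreSym, Pi.zero_apply]
    push_cast
    rw [sum_fin_pred_zmod (fun x : ZMod p => quadraticChar (ZMod p) ((((i : ℕ) : ZMod p) + 1) ^ 2 +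
      10 * (((i : ℕ) : ZMod p) + 1) * x + 9 * x ^ 2) * V x) (by simp [hV0]),
      ← sum_quadraticChar_quartic_eq_zero hp ha]
    rw [← Finset.sum_fiberwise Finset.univ (fun t : ZMod p => t ^ 2) fun t =>
      quadraticChar (ZMod p) ((((i : ℕ) : ZMod p) + 1) ^ 2 +
        10 * (((i : ℕ) : ZMod p) + 1) * t ^ 2 + 9 * (t ^ 2) ^ 2) * quadraticChar (ZMod p) t]
    refine Finset.sum_congr rfl fun x _ => ?_
    rw [Finset.mul_sum]
    refine Finset.sum_congr rfl fun t ht => ?_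
    rw [(Finset.mem_filter.1 ht).2]
end

section
/- Let p be a prime with p ≡ 13 or 17 (mod 20). Then the determinant det[((i²+5ij+5j²)/p)]_{0≤i,j≤p−1} = 0, where (·/p) is the Legendre symbol. -/
open PowerSeries in
theorem PowerSeries.coeff_pow_prime_mul_of_constantCoeff_eq_one {K : Type*} [Field K] (p : ℕ)
    [Fact p.Prime] [CharP K p] {V : K⟦X⟧} (hV : constantCoeff V = 1) (F : K⟦X⟧) :
    coeff (p - 1) (V ^ p * F) = coeff (p - 1) F := by
  have hp := (Fact.out : p.Prime).pos
  obtain ⟨W, hW⟩ := X_dvd_iff.mpr (show constantCoeff (V - 1) = 0 by simp [hV])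
  have : CharP K⟦X⟧ p := charP_of_injective_ringHom (C_injective (R := K)) p
  rw [show V = 1 + X * W by rw [← hW]; ring, add_pow_char, one_pow, mul_pow, add_mul, one_mul,
    map_add, mul_assoc, coeff_X_pow_mul', if_neg (by omega), add_zero]

open PowerSeries in
theorem PowerSeries.coeff_aeval_mul_derivative {K : Type*} [Field K] (p : ℕ)
    [Fact p.Prime] [CharP K p] {F : K⟦X⟧} (hF : constantCoeff F = 0) (G : Polynomial K) :
    coeff (p - 1) (Polynomial.aeval F G * d⁄dX K F) = G.coeff (p - 1) * coeff 1 F ^ p := by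
  have hp := (Fact.out : p.Prime).pos
  obtain ⟨W, rfl⟩ := X_dvd_iff.mpr hF
  have key (k : ℕ) : coeff (p - 1) ((X * W) ^ k * d⁄dX K (X * W)) =
      if k = p - 1 then coeff 1 (X * W) ^ p else 0 := by
    split_ifs with h
    · subst h
      have h1 : coeff (p - 1) ((X * W) ^ (p - 1) * d⁄dX K (X * W)) =
          coeff 0 (W ^ (p - 1) * d⁄dX K (X * W)) := by
        rw [mul_pow, mul_assoc, coeff_X_pow_mul', if_pos le_rfl, Nat.sub_self]
      rw [h1]
      simp only [coeff_zero_eq_constantCoeff, map_mul, map_pow]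
      rw [← coeff_zero_eq_constantCoeff_apply (d⁄dX K (X * W)), coeff_derivative]
      have h2 : coeff 1 (X * W) = constantCoeff W := by
        rw [show (1 : ℕ) = 0 + 1 from rfl, coeff_succ_X_mul, coeff_zero_eq_constantCoeff_apply]
      simp only [zero_add, h2, Nat.cast_zero, mul_one]
      rw [← pow_succ, Nat.sub_add_cancel hp]
    · rcases lt_or_gt_of_ne h with h | h
      · have hk : ((k + 1 : ℕ) : K) ≠ 0 := by
          rw [Ne, CharP.cast_eq_zero_iff K p]
          exact fun hd => by have := Nat.le_of_dvd k.succ_pos hd; omega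
        have h3 : coeff (p - 1) (d⁄dX K ((X * W) ^ (k + 1))) = 0 := by
          rw [coeff_derivative, ← Nat.cast_add_one, Nat.sub_add_cancel hp, CharP.cast_eq_zero,
            mul_zero]
        rw [derivative_pow, Nat.add_sub_cancel, mul_assoc, ← map_natCast (C (R := K)),
          coeff_C_mul] at h3
        exact (mul_eq_zero.mp h3).resolve_left hk
      · rw [mul_pow, mul_assoc, coeff_X_pow_mul', if_neg (by omega)]
  rw [Polynomial.aeval_eq_sum_range' (n := max (G.natDegree + 1) p) (by omega), Finset.sum_mul,
    map_sum]
  simp only [smul_mul_assoc, coeff_smul, key, smul_eq_mul]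
  rw [Finset.sum_eq_single (p - 1)]
  · simp
  · intro b _ hb; simp [hb]
  · intro h; simp at h; omega

/-- If `d² F' = κ V W` and `d⁴ r(F) = q V²`, so that formally `r(F)^(-1/2) dF = κ q^(-1/2) W dX`,
then the Hasse coefficients of both sides agree up to the factor `(F'(0))^p`. -/
theorem PowerSeries.coeff_pow_eq_of_differential_eq {K : Type*} [Field K] {p N : ℕ}
    [Fact p.Prime] [CharP K p] (hN : p = 2 * N + 1) {F d V q W : PowerSeries K}
    {r : Polynomial K} {κ : K} (hF : constantCoeff F = 0) (hd : constantCoeff d = 1)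
    (hV : constantCoeff V = 1) (h₁ : d ^ 2 * derivative K F = C κ * V * W)
    (h₂ : d ^ 4 * Polynomial.aeval F r = q * V ^ 2) :
    (r ^ N).coeff (p - 1) * coeff 1 F ^ p = κ * coeff (p - 1) (q ^ N * W) := by
  have hd' : constantCoeff (d ^ 2) = 1 := by simp [hd]
  rw [← coeff_aeval_mul_derivative p hF, ← coeff_pow_prime_mul_of_constantCoeff_eq_one p hd',
    ← coeff_C_mul, ← coeff_pow_prime_mul_of_constantCoeff_eq_one p hV (C κ * _)]
  congr 1
  calc (d ^ 2) ^ p * (Polynomial.aeval F (r ^ N) * derivative K F)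
      = (d ^ 4 * Polynomial.aeval F r) ^ N * (d ^ 2 * derivative K F) := by
        rw [map_pow, hN]; ring
    _ = V ^ p * (C κ * (q ^ N * W)) := by rw [h₁, h₂, hN]; ring

theorem cubic_transformation_identity {A : Type*} [CommRing A] {φ ι r E C : A}
    (hι : ι ^ 2 = -1) (hφ : φ ^ 2 = φ + 1) (hr : r = -φ + ι * (φ - 1))
    (hE : E = -(3 * φ + 2 + ι * (1 + φ))) (hC : C = 2 + ι * (2 * φ - 1)) (τ : A) :
    81 * (1 + r * τ) ^ 4 - 36 * C * τ * (3 + E * τ) ^ 2 * (1 + r * τ) ^ 2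
      + (3 - 2 * φ) * C ^ 2 * τ ^ 2 * (3 + E * τ) ^ 4 =
    81 * (1 - 4 * τ + (2 * φ + 1) * τ ^ 2) * (1 + (E - r) * τ + (2 * φ + 1) * τ ^ 2) ^ 2 := by
  have k1 : 4 * r - 4 * C = -4 + 2 * (E - r) := by subst hr hE hC; grind
  have k2 : 81 * 6 * r ^ 2 - 36 * C * (6 * E + 18 * r) + (3 - 2 * φ) * C ^ 2 * 81 =
      81 * ((E - r) ^ 2 + 2 * (2 * φ + 1) - 8 * (E - r) + (2 * φ + 1)) := by
    subst hr hE hC; grind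
  have k3 : 81 * 4 * r ^ 3 - 36 * C * (E ^ 2 + 12 * E * r + 9 * r ^ 2) +
      (3 - 2 * φ) * C ^ 2 * (108 * E) =
      81 * (2 * (E - r) * (2 * φ + 1) - 4 * ((E - r) ^ 2 + 2 * (2 * φ + 1)) +
        2 * (2 * φ + 1) * (E - r)) := by
    subst hr hE hC; grind
  have k4 : 81 * r ^ 4 - 36 * C * (2 * E ^ 2 * r + 6 * E * r ^ 2) +
      (3 - 2 * φ) * C ^ 2 * (54 * E ^ 2) =
      81 * ((2 * φ + 1) ^ 2 - 8 * (E - r) * (2 * φ + 1) +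
        (2 * φ + 1) * ((E - r) ^ 2 + 2 * (2 * φ + 1))) := by
    subst hr hE hC; grind
  have k5 : -36 * C * E ^ 2 * r ^ 2 + (3 - 2 * φ) * C ^ 2 * (12 * E ^ 3) =
      81 * (-4 * (2 * φ + 1) ^ 2 + 2 * (2 * φ + 1) * (E - r) * (2 * φ + 1)) := by
    subst hr hE hC; grind
  have k6 : (3 - 2 * φ) * C ^ 2 * E ^ 4 = 81 * (2 * φ + 1) ^ 3 := by subst hr hE hC; grind
  linear_combination 81 * τ * k1 + τ ^ 2 * k2 + τ ^ 3 * k3 + τ ^ 4 * k4 + τ ^ 5 * k5 + τ ^ 6 * k6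

open PowerSeries in
/-- `PowerSeries.coeff_pow_eq_of_differential_eq` for `F = n / d` and `r = 1 - 4 X² + b X⁴`. -/
theorem PowerSeries.coeff_quartic_pow_of_quotient {K : Type*} [Field K] {p N : ℕ}
    [Fact p.Prime] [CharP K p] (hN : p = 2 * N + 1) {n d V q W : PowerSeries K} {b κ : K}
    (hn : constantCoeff n = 0) (hd : constantCoeff d = 1) (hV : constantCoeff V = 1)
    (h₁ : d * derivative K n - n * derivative K d = C κ * V * W)
    (h₂ : d ^ 4 - 4 * n ^ 2 * d ^ 2 + C b * n ^ 4 = q * V ^ 2) :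
    ((1 - 4 * .X ^ 2 + .C b * .X ^ 4 : Polynomial K) ^ N).coeff (p - 1) * coeff 1 n ^ p =
      κ * coeff (p - 1) (q ^ N * W) := by
  obtain ⟨F, hF⟩ : ∃ F, F = n * d⁻¹ := ⟨_, rfl⟩
  have hn' : n = F * d := by
    rw [hF, mul_assoc, PowerSeries.inv_mul_cancel _ (by simp [hd]), mul_one]
  have hF0 : constantCoeff F = 0 := by simp [hF, hn]
  have hF1 : coeff 1 n = coeff 1 F := by
    simp [hn', coeff_mul, Finset.Nat.antidiagonal_succ, hF0, hd]
  rw [hF1]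
  subst hn'
  refine coeff_pow_eq_of_differential_eq hN hF0 hd hV ?_ ?_
  · rw [← h₁, Derivation.leibniz, smul_eq_mul, smul_eq_mul]
    ring
  · simp only [map_add, map_sub, map_mul, map_pow, Polynomial.aeval_X, Polynomial.aeval_C,
      map_one, map_ofNat, PowerSeries.algebraMap_apply, Algebra.algebraMap_self_apply]
    rw [← h₂]
    ring

open PowerSeries in
theorem coeff_quartic_pow_eq_coeff_quadratic_pow {K : Type*} [Field K] {p m : ℕ} [Fact p.Prime]
    [CharP K p] (hm : p = 4 * m + 1) (a : K) :
    ((1 - 4 * .X ^ 2 + .C (2 + a) * .X ^ 4 : Polynomial K) ^ (2 * m)).coeff (p - 1) =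
      ((1 + .C a * .X + .X ^ 2 : Polynomial K) ^ (2 * m)).coeff m := by
  have key := coeff_quartic_pow_of_quotient (K := K) (p := p) (N := 2 * m) (by omega)
    (n := X) (d := 1 + X ^ 2) (V := 1) (q := 1 + C a * X ^ 4 + X ^ 8)
    (W := 1 - X ^ 2) (b := 2 + a) (κ := 1) (by simp) (by simp) (by simp)
    (by
      simp only [derivative_X, map_add, derivative_pow, map_one, derivative_one]
      push_cast
      ring)
    (by rw [map_add, map_ofNat]; ring)
  rw [coeff_one_X, one_pow, mul_one, one_mul] at key
  rw [key]
  have hpoly : (1 + C a * X ^ 4 + X ^ 8 : K⟦X⟧) ^ (2 * m) =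
      ((Polynomial.expand K 4 ((1 + .C a * .X + .X ^ 2) ^ (2 * m)) : Polynomial K) : K⟦X⟧) := by
    simp only [map_pow, map_add, map_mul, map_one, Polynomial.expand_X, Polynomial.expand_C,
      Polynomial.coe_pow, Polynomial.coe_add, Polynomial.coe_mul, Polynomial.coe_one,
      Polynomial.coe_C, Polynomial.coe_X]
    ring
  have hm0 : 0 < m := by
    have := (Fact.out : p.Prime).one_lt
    omega
  rw [hpoly, mul_sub, mul_one, map_sub, coeff_mul_X_pow', if_pos (by omega), Polynomial.coeff_coe,
    Polynomial.coeff_coe, Polynomial.coeff_expand (by norm_num),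
    Polynomial.coeff_expand (by norm_num), if_pos (by omega), if_neg (by omega), sub_zero,
    show (p - 1) / 4 = m by omega]

open PowerSeries in
theorem coeff_quartic_pow_cubic_transformation {K : Type*} [Field K] {p N : ℕ} [Fact p.Prime]
    [CharP K p] (hN : p = 2 * N + 1) (h3 : (3 : K) ≠ 0) {φ ι c : K}
    (hφ : φ ^ 2 = φ + 1) (hι : ι ^ 2 = -1) (hc : c ^ 2 = 2 + ι * (2 * φ - 1)) :
    ((1 - 4 * .X ^ 2 + .C (3 - 2 * φ) * .X ^ 4 : Polynomial K) ^ N).coeff (p - 1) * c ^ p =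
      c * ((1 - 4 * .X ^ 2 + .C (2 * φ + 1) * .X ^ 4 : Polynomial K) ^ N).coeff (p - 1) := by
  obtain ⟨r, hr⟩ : ∃ r : K, r = -φ + ι * (φ - 1) := ⟨_, rfl⟩
  obtain ⟨E, hE⟩ : ∃ E : K, E = -(3 * φ + 2 + ι * (1 + φ)) := ⟨_, rfl⟩
  obtain ⟨e, he⟩ : ∃ e : K, 3 * e = E := ⟨_, mul_div_cancel₀ _ h3⟩
  have her : e * r = 2 * φ + 1 := by
    refine mul_left_cancel₀ h3 ?_
    rw [← mul_assoc, he, hE, hr]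
    clear he hE hr hc
    grind
  have h3' : C (3 : K) * C e = C E := by rw [← map_mul, he]
  have her' : C e * C r = C (2 * φ + 1) := by rw [← map_mul, her]
  have hc' : C c ^ 2 = C (2 + ι * (2 * φ - 1)) := by rw [← map_pow, hc]
  have key := cubic_transformation_identity (A := K⟦X⟧) (φ := C φ) (ι := C ι) (r := C r)
    (E := C E) (C := C (2 + ι * (2 * φ - 1)))
    (by rw [← map_pow, hι]; simp) (by rw [← map_pow, hφ]; simp) (by rw [hr]; simp)
    (by rw [hE]; simp [map_ofNat]) (by simp [map_ofNat]) (X ^ 2)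
  have h81 : (81 : K⟦X⟧) ≠ 0 := by
    have : (81 : K) ≠ 0 := by
      rw [show (81 : K) = 3 ^ 4 by norm_num]
      exact pow_ne_zero 4 h3
    simpa only [map_ofNat] using (map_ne_zero_iff (C (R := K)) C_injective).mpr this
  have hlin : coeff 1 (C c * X * (1 + C e * X ^ 2) : K⟦X⟧) = c := by
    rw [mul_assoc, coeff_C_mul, show (1 : ℕ) = 0 + 1 from rfl, coeff_succ_X_mul]
    simp
  have main := coeff_quartic_pow_of_quotient (K := K) (p := p) hN
    (n := C c * X * (1 + C e * X ^ 2)) (d := 1 + C r * X ^ 2)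
    (V := 1 + C (E - r) * X ^ 2 + C (2 * φ + 1) * X ^ 4)
    (q := 1 - 4 * X ^ 2 + C (2 * φ + 1) * X ^ 4) (W := 1) (b := 3 - 2 * φ) (κ := c)
    (by simp) (by simp) (by simp)
    (by
      simp only [Derivation.leibniz, derivative_X, map_add, derivative_pow, map_one, derivative_one,
        smul_eq_mul, derivative_C, map_sub]
      push_cast
      simp only [map_add, map_mul, map_ofNat, map_one] at her' h3' ⊢
      linear_combination C c * X ^ 2 * h3' + C c * X ^ 4 * her')
    (by
      refine mul_left_cancel₀ h81 ?_
      simp only [map_add, map_sub, map_mul, map_ofNat, map_one] at her' h3' hc' key ⊢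
      rw [← h3'] at key ⊢
      linear_combination key + (-324 * X ^ 2 * (1 + C e * X ^ 2) ^ 2 * (1 + C r * X ^ 2) ^ 2 +
        81 * (3 - 2 * C φ) * X ^ 4 * (1 + C e * X ^ 2) ^ 4 *
          (C c ^ 2 + (2 + C ι * (2 * C φ - 1)))) * hc')
  rw [hlin, mul_one] at main
  rw [main, ← Polynomial.coeff_coe]
  have h4 : ((4 : Polynomial K) : K⟦X⟧) = 4 :=
    map_ofNat (Polynomial.coeToPowerSeries.ringHom (R := K)) 4
  congr 2
  push_cast
  simp [map_ofNat, h4]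

open Polynomial in
theorem coeff_quadratic_pow_eq_zero {K : Type*} [Field K] [IsAlgClosed K] {p m : ℕ}
    [Fact p.Prime] [CharP K p] (hm : p = 4 * m + 1) {s : K} (hs : s ^ 2 = 5)
    (hsp : s ^ p = -s) (hs0 : s ≠ 0) (h2 : (2 : K) ≠ 0) (h3 : (3 : K) ≠ 0) :
    ((1 + C s * X + X ^ 2 : K[X]) ^ (2 * m)).coeff m = 0 := by
  obtain ⟨ι, hι⟩ := IsAlgClosed.exists_pow_nat_eq (-1 : K) two_pos
  obtain ⟨φ, hφs⟩ : ∃ φ : K, 2 * φ = 1 + s := ⟨_, mul_div_cancel₀ _ h2⟩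
  have hφ : φ ^ 2 = φ + 1 := by
    refine mul_left_cancel₀ (mul_ne_zero h2 h2) ?_
    linear_combination (2 * φ + s - 1) * hφs + hs
  obtain ⟨c, hc⟩ := IsAlgClosed.exists_pow_nat_eq (2 + ι * (2 * φ - 1)) two_pos
  have key := coeff_quartic_pow_cubic_transformation (p := p) (N := 2 * m) (by omega) h3 hφ hι hc
  rw [show 3 - 2 * φ = 2 + -s by rw [hφs]; ring, show 2 * φ + 1 = 2 + s by rw [hφs]; ring,
    coeff_quartic_pow_eq_coeff_quadratic_pow hm, coeff_quartic_pow_eq_coeff_quadratic_pow hm] at key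
  have hneg : ((1 + C (-s) * X + X ^ 2 : K[X]) ^ (2 * m)).coeff m =
      ((1 + C s * X + X ^ 2 : K[X]) ^ (2 * m)).coeff m * (-1) ^ m := by
    rw [← comp_C_mul_X_coeff]
    congr 1
    simp [pow_comp]
  rw [hneg] at key
  have hι0 : ι ≠ 0 := by rintro rfl; norm_num at hι
  have hιp : ι ^ p = ι := by
    rw [hm, pow_succ, show 4 * m = 2 * (2 * m) by ring, pow_mul, hι, pow_mul]
    simp
  have hcp : (c ^ p) ^ 2 = 2 - ι * s := by
    rw [← pow_mul, mul_comm, pow_mul, hc, hφs, add_sub_cancel_left, add_pow_char, mul_pow, hιp, hsp]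
    have : (2 : K) ^ p = 2 := by
      have h := congrArg (ZMod.castHom (dvd_refl p) K) (ZMod.pow_card (2 : ZMod p))
      simpa only [map_pow, map_ofNat] using h
    rw [this]; ring
  rw [hφs, add_sub_cancel_left] at hc
  have h1 : ((-1 : K) ^ m) ^ 2 = 1 := by rw [← pow_mul, mul_comm, pow_mul]; simp
  generalize ((1 + C s * X + X ^ 2 : K[X]) ^ (2 * m)).coeff m = A at key ⊢
  have hA : A ^ 2 * (2 * ι * s) = 0 := by
    have := congrArg (· ^ 2) key
    simp only [mul_pow, h1, hcp, hc] at this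
    linear_combination -this
  simpa [h2, hι0, hs0] using hA

open Polynomial in
theorem coeff_quadratic_pow_symm {R : Type*} [CommRing R] [Nontrivial R] (a : R) (N k l : ℕ)
    (h : k + l = 2 * N) :
    ((1 + C a * X + X ^ 2 : R[X]) ^ N).coeff k = ((1 + C a * X + X ^ 2 : R[X]) ^ N).coeff l := by
  have hrefl : ∀ N : ℕ, reflect (2 * N) ((1 + C a * X + X ^ 2 : R[X]) ^ N) =
      (1 + C a * X + X ^ 2) ^ N := by
    intro N
    have hdeg : (1 + C a * X + X ^ 2 : R[X]).natDegree ≤ 2 := by compute_degree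
    induction N with
    | zero => simp
    | succ N ih =>
      rw [pow_succ, mul_add, reflect_mul _ _ ((natDegree_pow_le_of_le N hdeg).trans (by omega))
        (by simpa using hdeg), ih]
      congr 1
      have hX : reflect 2 (X : R[X]) = X := by
        simpa [revAt_le] using reflect_monomial (R := R) 2 1
      have hX2 : reflect 2 (X ^ 2 : R[X]) = 1 := by
        simp [reflect_monomial]
      have h1 : reflect 2 (1 : R[X]) = X ^ 2 := by simp
      rw [mul_one, reflect_add, reflect_add, reflect_C_mul, hX, hX2, h1]
      ring
  conv_lhs => rw [← hrefl N, coeff_reflect, revAt_le (by omega)]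
  congr 1
  omega

open Polynomial in
theorem coeff_one_add_five_mul_pow_eq_zero {p m : ℕ} [Fact p.Prime] (hm : p = 4 * m + 1)
    (h5 : (5 : ZMod p) ^ (2 * m) = -1) :
    ((1 + 5 * X + 5 * X ^ 2 : (ZMod p)[X]) ^ (2 * m)).coeff m = 0 ∧
      ((1 + 5 * X + 5 * X ^ 2 : (ZMod p)[X]) ^ (2 * m)).coeff (3 * m) = 0 := by
  let K := AlgebraicClosure (ZMod p)
  have : CharP K p := charP_of_injective_algebraMap (algebraMap (ZMod p) K).injective p
  have hp := (Fact.out : p.Prime)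
  obtain ⟨s, hs⟩ := IsAlgClosed.exists_pow_nat_eq (5 : K) two_pos
  have h5K : (5 : K) ^ (2 * m) = -1 := by
    simpa only [map_pow, map_neg, map_one, map_ofNat] using congrArg (algebraMap (ZMod p) K) h5
  have hm0 : m ≠ 0 := by rintro rfl; exact hp.one_lt.ne' hm
  have hs0 : s ≠ 0 := by
    rintro rfl
    rw [← hs] at h5K
    simp [hm0] at h5K
  have hsp : s ^ p = -s := by
    rw [congrArg (s ^ ·) hm, pow_succ, show 4 * m = 2 * (2 * m) by ring, pow_mul, hs, h5K,
      neg_one_mul]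
  have hne (n : ℕ) (h0 : 0 < n) (h : n < 5) : ((n : ℕ) : K) ≠ 0 := by
    rw [Ne, CharP.cast_eq_zero_iff K p]
    exact fun hd => by have := Nat.le_of_dvd h0 hd; omega
  have hzero : ((1 + C s * X + X ^ 2 : K[X]) ^ (2 * m)).coeff m = 0 :=
    coeff_quadratic_pow_eq_zero hm hs hsp hs0 (by exact_mod_cast hne 2 (by norm_num) (by norm_num))
      (by exact_mod_cast hne 3 (by norm_num) (by norm_num))
  have hmap (k : ℕ) : algebraMap (ZMod p) K
      (((1 + 5 * X + 5 * X ^ 2 : (ZMod p)[X]) ^ (2 * m)).coeff k) =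
      ((1 + C s * X + X ^ 2 : K[X]) ^ (2 * m)).coeff k * s ^ k := by
    rw [← coeff_map, ← comp_C_mul_X_coeff]
    congr 1
    have hCs : C s * C s = (5 : K[X]) := by rw [← C_mul, ← sq, hs, map_ofNat]
    simp only [Polynomial.map_pow, Polynomial.map_add, Polynomial.map_mul, Polynomial.map_one,
      Polynomial.map_ofNat, Polynomial.map_X, pow_comp, add_comp, mul_comp, one_comp, C_comp,
      X_comp]
    rw [mul_pow, sq (C s), ← mul_assoc, hCs]
  refine ⟨(algebraMap (ZMod p) K).injective ?_, (algebraMap (ZMod p) K).injective ?_⟩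
  · rw [hmap, hzero, zero_mul, map_zero]
  · rw [hmap, coeff_quadratic_pow_symm s (2 * m) (3 * m) m (by ring), hzero, zero_mul, map_zero]

theorem FiniteField.sum_pow_eq_ite_of_lt {K : Type*} [Field K] [Fintype K] {i : ℕ}
    (hi : i < 2 * (Fintype.card K - 1)) :
    ∑ x : K, x ^ i = if i = Fintype.card K - 1 then -1 else 0 := by
  classical
  have hq := Fintype.one_lt_card (α := K)
  split_ifs with h
  · have (x : K) : x ^ i = 1 - if x = 0 then 1 else 0 := by
      split_ifs with hx
      · simp [hx, show i ≠ 0 by omega]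
      · rw [h, FiniteField.pow_card_sub_one_eq_one x hx, sub_zero]
    simp [this]
  · rcases lt_or_gt_of_ne h with h | h
    · exact FiniteField.sum_pow_lt_card_sub_one K i h
    · obtain ⟨k, rfl⟩ := Nat.exists_eq_add_of_lt h
      rw [← FiniteField.sum_pow_lt_card_sub_one K (k + 1) (by omega)]
      refine Finset.sum_congr rfl fun x _ => ?_
      rw [show Fintype.card K - 1 + k + 1 = Fintype.card K + k by omega, pow_add,
        FiniteField.pow_card, pow_succ']

theorem FiniteField.sum_eval_eq_neg_coeff {K : Type*} [Field K] [Fintype K] {f : Polynomial K}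
    (hf : f.natDegree < 2 * (Fintype.card K - 1)) :
    ∑ x, f.eval x = -f.coeff (Fintype.card K - 1) := by
  simp only [Polynomial.eval_eq_sum_range' hf]
  rw [Finset.sum_comm]
  simp only [← Finset.mul_sum]
  rw [Finset.sum_eq_single (Fintype.card K - 1)]
  · rw [FiniteField.sum_pow_eq_ite_of_lt (by omega), if_pos rfl, mul_neg_one]
  · intro i hi hne
    rw [FiniteField.sum_pow_eq_ite_of_lt (Finset.mem_range.mp hi), if_neg hne, mul_zero]
  · intro h
    simp at h
    omega

open Polynomial in
theorem sum_quadratic_pow_mul_pow_eq_zero {p m : ℕ} [Fact p.Prime] (hm : p = 4 * m + 1)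
    (h5 : (5 : ZMod p) ^ (2 * m) = -1) {k l : ℕ} (hk : k = m ∧ l = 3 * m ∨ k = 3 * m ∧ l = m) :
    ∑ x : ZMod p, (1 + 5 * x + 5 * x ^ 2) ^ (2 * m) * x ^ k = 0 := by
  have hm0 : 0 < m := by
    have := (Fact.out : p.Prime).one_lt
    omega
  have hdeg : ((1 + 5 * X + 5 * X ^ 2 : (ZMod p)[X]) ^ (2 * m) * X ^ k).natDegree ≤
      2 * m * 2 + k := by
    refine natDegree_mul_le_of_le (natDegree_pow_le_of_le _ ?_) (natDegree_X_pow_le k)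
    compute_degree
  have h := FiniteField.sum_eval_eq_neg_coeff (hdeg.trans_lt (by rw [ZMod.card]; omega))
  rw [ZMod.card, show p - 1 = l + k by omega, coeff_mul_X_pow] at h
  have hl : ((1 + 5 * X + 5 * X ^ 2 : (ZMod p)[X]) ^ (2 * m)).coeff l = 0 := by
    obtain ⟨h1, h3⟩ := coeff_one_add_five_mul_pow_eq_zero hm h5
    rcases hk with ⟨-, rfl⟩ | ⟨-, rfl⟩ <;> assumption
  rw [hl, neg_zero] at h
  simpa using h

theorem GaussianInt.abs_re_le_one_and_abs_im_le_one_of_isUnit {z : GaussianInt} (hz : IsUnit z) :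
    |z.re| ≤ 1 ∧ |z.im| ≤ 1 := by
  have h : z.norm = 1 := (Zsqrtd.norm_eq_one_iff' (by norm_num) z).mpr hz
  rw [Zsqrtd.norm_def] at h
  constructor <;> rw [← sq_le_one_iff_abs_le_one] <;> nlinarith [sq_nonneg z.re, sq_nonneg z.im]

/-- There is a quartic character of `𝔽_p` with values in `ℤ[i]` whose reductions modulo the two
primes above `p` are `x ↦ x ^ m` and `x ↦ x ^ (3 * m)`. -/
theorem exists_quartic_mulChar {p m : ℕ} [Fact p.Prime] (hm : p = 4 * m + 1) :
    ∃ (ψ : MulChar (ZMod p) GaussianInt) (a : ZMod p), ψ ≠ 1 ∧ a ^ 2 = -1 ∧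
      ∀ x, ((ψ x).re + (ψ x).im * a : ZMod p) = x ^ m ∧
        ((ψ x).re - (ψ x).im * a : ZMod p) = x ^ (3 * m) := by
  have hm0 : m ≠ 0 := by
    have := (Fact.out : p.Prime).one_lt
    omega
  obtain ⟨g, hg⟩ := IsCyclic.exists_generator (α := (ZMod p)ˣ)
  have hord : orderOf g = 4 * m := by
    rw [orderOf_eq_card_of_forall_mem_zpowers hg, Nat.card_eq_fintype_card,
      ZMod.card_units_eq_totient, Nat.totient_prime Fact.out, hm, Nat.add_sub_cancel]
  let i : GaussianInt := ⟨0, 1⟩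
  have hi : i * i = -1 := rfl
  let ζ : GaussianIntˣ := ⟨i, -i, by rw [mul_neg, hi, neg_neg], by rw [neg_mul, hi, neg_neg]⟩
  have hζ : ζ ∈ rootsOfUnity (Fintype.card (ZMod p)ˣ) GaussianInt := by
    rw [mem_rootsOfUnity, ZMod.card_units_eq_totient, Nat.totient_prime Fact.out,
      show p - 1 = 4 * m by omega, pow_mul, show ζ ^ 4 = 1 by ext1; rfl, one_pow]
  let ψ := MulChar.ofRootOfUnity hζ hg
  have hψ : ψ g = i := MulChar.ofRootOfUnity_spec hζ hg
  have hg2 : ((g : ZMod p) ^ m) ^ 2 = -1 := by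
    have h4 : ((g : ZMod p) ^ m) ^ 2 * ((g : ZMod p) ^ m) ^ 2 = 1 := by
      rw [← pow_mul, ← pow_add, show m * 2 + m * 2 = 4 * m by ring, ← hord]
      rw [← Units.val_pow_eq_pow_val, pow_orderOf_eq_one, Units.val_one]
    refine (mul_self_eq_one_iff.mp h4).resolve_left fun h => ?_
    have h1 : g ^ (m * 2) = 1 := Units.ext (by push_cast; rw [pow_mul, h])
    have := Nat.le_of_dvd (by omega) (hord ▸ orderOf_dvd_of_pow_eq_one h1)
    omega
  have hlift (b : ZMod p) (hb : b * b = ((-1 : ℤ) : ZMod p)) {k : ℕ} (hk : k ≠ 0)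
      (hgk : (g : ZMod p) ^ k = b) (x : ZMod p) : ((ψ x).re + (ψ x).im * b : ZMod p) = x ^ k := by
    change Zsqrtd.lift ⟨b, hb⟩ (ψ x) = x ^ k
    rcases eq_or_ne x 0 with rfl | hx
    · rw [MulChar.map_zero, map_zero, zero_pow hk]
    · obtain ⟨n, hn⟩ := (mem_powers_iff_mem_zpowers).mpr (hg (Units.mk0 x hx))
      have hx' : x = (g : ZMod p) ^ n := by
        simpa using (congrArg Units.val hn).symm
      rw [hx', map_pow, map_pow, hψ, pow_right_comm, hgk]
      simp [i]
  refine ⟨ψ, (g : ZMod p) ^ m, fun h => ?_, hg2, fun x => ⟨?_, ?_⟩⟩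
  · rw [h, MulChar.one_apply g.isUnit] at hψ
    exact absurd (congrArg Zsqrtd.re hψ) (by simp [i])
  · exact hlift _ (by rw [← sq, hg2]; simp) hm0 rfl x
  · rw [sub_eq_add_neg, ← mul_neg]
    refine hlift _ (by rw [neg_mul_neg, ← sq, hg2]; simp) (by omega) ?_ x
    rw [mul_comm, pow_mul, pow_succ, hg2, neg_one_mul]

theorem sum_quadraticChar_mul_eq_zero {p m : ℕ} [Fact p.Prime] (hm : p = 4 * m + 1)
    (h5 : (5 : ZMod p) ^ (2 * m) = -1) {ψ : MulChar (ZMod p) GaussianInt} {a : ZMod p}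
    (ha : a ^ 2 = -1) (hψ : ∀ x, ((ψ x).re + (ψ x).im * a : ZMod p) = x ^ m ∧
        ((ψ x).re - (ψ x).im * a : ZMod p) = x ^ (3 * m)) :
    ∑ x, ((quadraticChar (ZMod p) (1 + 5 * x + 5 * x ^ 2) : ℤ) : GaussianInt) * ψ x = 0 := by
  have hp := (Fact.out : p.Prime)
  have hχ (y : ZMod p) : ((quadraticChar (ZMod p) y : ℤ) : ZMod p) = y ^ (2 * m) := by
    rw [quadraticChar_eq_pow_of_char_ne_two' (by rw [ZMod.ringChar_zmod_n]; omega), ZMod.card]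
    congr 1
    omega
  have h1 := sum_quadratic_pow_mul_pow_eq_zero hm h5 (.inl ⟨rfl, rfl⟩)
  have h3 := sum_quadratic_pow_mul_pow_eq_zero hm h5 (.inr ⟨rfl, rfl⟩)
  have h2 : (2 : ZMod p) ≠ 0 := Ring.two_ne_zero (by rw [ZMod.ringChar_zmod_n]; omega)
  have ha0 : a ≠ 0 := by rintro rfl; norm_num at ha
  have hbound (f : ZMod p → ℤ) (h : ∀ x, |f x| ≤ 1) (h0 : f 0 = 0)
      (hf : ∑ x, (f x : ZMod p) = 0) : ∑ x, f x = 0 := by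
    rw [← Int.cast_sum, ZMod.intCast_zmod_eq_zero_iff_dvd] at hf
    refine Int.eq_zero_of_abs_lt_dvd hf ?_
    rw [← Finset.sum_erase _ h0]
    refine ((Finset.abs_sum_le_sum_abs _ _).trans
      (Finset.sum_le_card_nsmul _ _ 1 fun x _ => h x)).trans_lt ?_
    rw [Finset.card_erase_of_mem (Finset.mem_univ _), Finset.card_univ, ZMod.card]
    rw [nsmul_one]
    exact_mod_cast Nat.sub_one_lt hp.ne_zero
  have hψ0 : ψ 0 = 0 := ψ.map_zero
  have hψ1 (x) : |(ψ x).re| ≤ 1 ∧ |(ψ x).im| ≤ 1 := by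
    rcases eq_or_ne x 0 with rfl | hx
    · simp [hψ0]
    · exact GaussianInt.abs_re_le_one_and_abs_im_le_one_of_isUnit (hx.isUnit.map ψ)
  have hχ1 (y) : |quadraticChar (ZMod p) y| ≤ 1 := by
    rcases eq_or_ne y 0 with rfl | hy
    · simp
    · rcases quadraticChar_dichotomy hy with h | h <;> simp [h]
  simp only [← hχ, ← (hψ _).1, ← (hψ _).2, mul_add, mul_sub, Finset.sum_add_distrib,
    Finset.sum_sub_distrib, ← mul_assoc, ← Finset.sum_mul] at h1 h3
  have hre : ∑ x, ((quadraticChar (ZMod p) (1 + 5 * x + 5 * x ^ 2) : ℤ) : ZMod p) *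
      (ψ x).re = 0 := by
    refine mul_left_cancel₀ h2 ?_
    linear_combination h1 + h3
  have him : ∑ x, ((quadraticChar (ZMod p) (1 + 5 * x + 5 * x ^ 2) : ℤ) : ZMod p) *
      (ψ x).im = 0 := by
    refine mul_left_cancel₀ (mul_ne_zero h2 ha0) ?_
    linear_combination h1 - h3
  have hmul (x y : ℤ) (hx : |x| ≤ 1) (hy : |y| ≤ 1) : |x * y| ≤ 1 := by
    rw [abs_mul]
    exact mul_le_one₀ hx (abs_nonneg y) hy
  let reHom : GaussianInt →+ ℤ := ⟨⟨Zsqrtd.re, rfl⟩, fun _ _ => rfl⟩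
  let imHom : GaussianInt →+ ℤ := ⟨⟨Zsqrtd.im, rfl⟩, fun _ _ => rfl⟩
  ext
  · refine (map_sum reHom _ _).trans ?_
    refine (Finset.sum_congr rfl fun x _ => Zsqrtd.re_smul _ _).trans ?_
    refine hbound _ (fun x => hmul _ _ (hχ1 _) (hψ1 x).1) (by simp [hψ0]) ?_
    simpa only [Int.cast_mul] using hre
  · refine (map_sum imHom _ _).trans ?_
    refine (Finset.sum_congr rfl fun x _ => Zsqrtd.im_smul _ _).trans ?_
    refine hbound _ (fun x => hmul _ _ (hχ1 _) (hψ1 x).2) (by simp [hψ0]) ?_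
    simpa only [Int.cast_mul] using him

theorem det_quadraticChar_eq_zero {p m : ℕ} [Fact p.Prime] (hm : p = 4 * m + 1)
    (h5 : (5 : ZMod p) ^ (2 * m) = -1) :
    (Matrix.of fun i j : ZMod p =>
      quadraticChar (ZMod p) (i ^ 2 + 5 * i * j + 5 * j ^ 2)).det = 0 := by
  obtain ⟨ψ, a, hψ, ha, h⟩ := exists_quartic_mulChar hm
  have key := sum_quadraticChar_mul_eq_zero hm h5 ha h
  refine (Int.castRingHom GaussianInt).injective_int ?_
  rw [RingHom.map_det, map_zero, ← Matrix.exists_mulVec_eq_zero_iff]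
  refine ⟨ψ, fun h0 => one_ne_zero ((map_one ψ).symm.trans (congrFun h0 1)), funext fun i => ?_⟩
  simp only [Matrix.mulVec, dotProduct, RingHom.mapMatrix_apply, Matrix.map_apply, Matrix.of_apply,
    Int.coe_castRingHom, Pi.zero_apply]
  rcases eq_or_ne i 0 with rfl | hi
  · rw [← mul_zero ((quadraticChar (ZMod p) 5 : ℤ) : GaussianInt),
      ← MulChar.sum_eq_zero_of_ne_one hψ, Finset.mul_sum]
    refine Finset.sum_congr rfl fun j _ => ?_
    rcases eq_or_ne j 0 with rfl | hj
    · rw [ψ.map_zero, mul_zero, mul_zero]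
    · rw [show (0 : ZMod p) ^ 2 + 5 * 0 * j + 5 * j ^ 2 = 5 * j ^ 2 by simp, map_mul,
        quadraticChar_sq_one' hj, mul_one]
  · rw [← mul_zero (ψ i), ← key, Finset.mul_sum]
    refine (Fintype.sum_equiv (Equiv.mulLeft₀ i hi) _ _ fun x => ?_).symm
    rw [Equiv.mulLeft₀_apply, map_mul ψ, show i ^ 2 + 5 * i * (i * x) + 5 * (i * x) ^ 2 =
      i ^ 2 * (1 + 5 * x + 5 * x ^ 2) by ring, map_mul (quadraticChar (ZMod p)),
      quadraticChar_sq_one' hi, one_mul, mul_left_comm]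

theorem stmt_16 (p : ℕ) [Fact p.Prime] (hp : p % 20 = 13 ∨ p % 20 = 17) :
    Matrix.det (Matrix.of fun i j : Fin p =>
        legendreSym p (((i : ℕ) : ℤ) ^ 2 + 5 * ((i : ℕ) : ℤ) * ((j : ℕ) : ℤ)
          + 5 * ((j : ℕ) : ℤ) ^ 2)) = 0 := by
  obtain ⟨m, hm⟩ : ∃ m, p = 4 * m + 1 := ⟨p / 4, by omega⟩
  have h5 : (5 : ZMod p) ^ (2 * m) = -1 := by
    have hnonsq : ¬IsSquare ((2 : ℕ) : ZMod 5) ∧ ¬IsSquare ((3 : ℕ) : ZMod 5) := by decide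
    have : Fact (Nat.Prime 5) := ⟨by norm_num⟩
    have hleg : legendreSym p (5 : ℕ) = -1 := by
      rw [legendreSym.eq_neg_one_iff', ZMod.exists_sq_eq_prime_iff_of_mod_four_eq_one (by omega)
        (by norm_num), ← ZMod.natCast_mod]
      obtain h | h : p % 5 = 2 ∨ p % 5 = 3 := by omega
      · exact h ▸ hnonsq.1
      · exact h ▸ hnonsq.2
    have := legendreSym.eq_pow p (5 : ℕ)
    rw [hleg, show p / 2 = 2 * m by omega] at this
    simpa using this.symm
  have hbij : Function.Bijective fun i : Fin p => ((i : ℕ) : ZMod p) := by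
    refine (Fintype.bijective_iff_injective_and_card _).mpr ⟨fun i j hij => ?_, by simp⟩
    exact Fin.ext (Nat.ModEq.eq_of_lt_of_lt ((ZMod.natCast_eq_natCast_iff _ _ _).mp hij) i.2 j.2)
  rw [← det_quadraticChar_eq_zero hm h5, ← Matrix.det_submatrix_equiv_self (.ofBijective _ hbij)]
  congr 1
  ext i j
  simp [legendreSym]
end
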